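/- arXiv:1805.10032 — 2 statements merged into one kernel-verified Lean document; each statement's English description precedes it below -/
import Mathlib

section
/- Let h : ℝ^d → ℝ be differentiable, L-smooth and μ-weakly convex, i.e. ⟨∇h(x), y − x⟩ + (μ/2)‖y − x‖² ≤ h(y) − h(x) ≤ ⟨∇h(x), y − x⟩ + (L/2)‖y − x‖² for all x, y ∈ ℝ^d, with μ ≤ L and L > 0. Let γ > 0, let β ≥ 0 satisfy β ≥ −μ (with β = 0 allowed when μ ≥ 0), and set ρ = βγ²/2. Fix x ∈ ℝ^d and suppose w_1, …, w_k ∈ ℝ^d and u_1, …, u_k ∈ ℝ^d (k ≥ 1) satisfy the score-domination condition h(x) − h(x − γ w_i) − ρ‖w_i‖² ≥ h(x) − h(x − γ u_i) − ρ‖u_i‖² for every i ∈ {1, …, k}. Let w̄ and ū denote the averages of the w_i and the u_i respectively. Then h(x − γ w̄) ≤ h(x − γ ū) + ((L + β) γ² / (2k)) Σ_{i=1}^k ‖u_i‖². -/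
open scoped RealInnerProductSpace

lemma zeno_var {E : Type*} [NormedAddCommGroup E] [InnerProductSpace ℝ E] {k : ℕ}
    (v : Fin k → E) (m : E) (hm : ∑ i, v i = (k : ℝ) • m) :
    ∑ i, ‖v i - m‖ ^ 2 ≤ ∑ i, ‖v i‖ ^ 2 := by
  have h1 : ∀ i, ‖v i - m‖ ^ 2 = ‖v i‖ ^ 2 - 2 * ⟪v i, m⟫ + ‖m‖ ^ 2 :=
    fun i => norm_sub_sq_real _ _
  have h2 : ∑ i, ⟪v i, m⟫ = k * ‖m‖ ^ 2 := by
    rw [← sum_inner, hm, real_inner_smul_left, real_inner_self_eq_norm_sq]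
  have h3 : 0 ≤ (k : ℝ) * ‖m‖ ^ 2 := by positivity
  simp only [h1, Finset.sum_add_distrib, Finset.sum_sub_distrib, ← Finset.mul_sum, h2]
  simp only [Finset.sum_const, Finset.card_univ, Fintype.card_fin, nsmul_eq_mul]
  linarith

lemma zeno_lin {E : Type*} [NormedAddCommGroup E] [InnerProductSpace ℝ E] {k : ℕ}
    (v : Fin k → E) (m a : E) (hm : ∑ i, v i = (k : ℝ) • m) :
    ∑ i, ⟪a, v i - m⟫ = 0 := by
  rw [← inner_sum, Finset.sum_sub_distrib, hm]
  simp [← Nat.cast_smul_eq_nsmul ℝ]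

/-- Deterministic core of Zeno's one-step descent guarantee: if `h` is `L`-smooth and
`μ`-weakly convex, `ρ = βγ²/2` with `β ≥ 0`, `β ≥ -μ`, and each selected update `wᵢ` has
stochastic descendant score at least that of the corresponding `uᵢ`, then
`h (x - γ w̄) ≤ h (x - γ ū) + ((L + β) γ² / (2k)) Σᵢ ‖uᵢ‖²`. -/
theorem zeno_score_domination_descent {d : ℕ} (L μ : ℝ) (hL : 0 < L) (hμL : μ ≤ L)
    (h : EuclideanSpace ℝ (Fin d) → ℝ)
    (hdiff : Differentiable ℝ h)
    (hlower : ∀ x y : EuclideanSpace ℝ (Fin d),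
      ⟪gradient h x, y - x⟫ + μ / 2 * ‖y - x‖ ^ 2 ≤ h y - h x)
    (hupper : ∀ x y : EuclideanSpace ℝ (Fin d),
      h y - h x ≤ ⟪gradient h x, y - x⟫ + L / 2 * ‖y - x‖ ^ 2)
    (γ β ρ : ℝ) (hγ : 0 < γ) (hβ0 : 0 ≤ β) (hβμ : -μ ≤ β) (hρ : ρ = β * γ ^ 2 / 2)
    {k : ℕ} (hk : 1 ≤ k)
    (x : EuclideanSpace ℝ (Fin d))
    (w u : Fin k → EuclideanSpace ℝ (Fin d))
    (hscore : ∀ i,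
      h x - h (x - γ • w i) - ρ * ‖w i‖ ^ 2 ≥ h x - h (x - γ • u i) - ρ * ‖u i‖ ^ 2)
    (wbar ubar : EuclideanSpace ℝ (Fin d))
    (hwbar : wbar = (k : ℝ)⁻¹ • ∑ i, w i) (hubar : ubar = (k : ℝ)⁻¹ • ∑ i, u i) :
    h (x - γ • wbar) ≤ h (x - γ • ubar) + (L + β) * γ ^ 2 / (2 * k) * ∑ i, ‖u i‖ ^ 2 := by
  have hk0 : (0 : ℝ) < k := by exact_mod_cast hk
  have hw : ∑ i, w i = (k : ℝ) • wbar := by rw [hwbar, smul_inv_smul₀ hk0.ne']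
  have hu : ∑ i, u i = (k : ℝ) • ubar := by rw [hubar, smul_inv_smul₀ hk0.ne']
  have key : ∀ v m : EuclideanSpace ℝ (Fin d), (x - γ • v) - (x - γ • m) = (-γ) • (v - m) := by
    intro v m
    module
  have key2 : ∀ v m : EuclideanSpace ℝ (Fin d),
      ‖(-γ) • (v - m)‖ ^ 2 = γ ^ 2 * ‖v - m‖ ^ 2 := by
    intro v m
    rw [norm_smul, mul_pow, norm_neg, Real.norm_eq_abs, sq_abs]
  have main : ∀ i, h (x - γ • wbar) + ((-γ) * ⟪gradient h (x - γ • wbar), w i - wbar⟫) ≤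
      h (x - γ • ubar) + ((-γ) * ⟪gradient h (x - γ • ubar), u i - ubar⟫)
      + (L * γ ^ 2 / 2) * ‖u i - ubar‖ ^ 2 + (β * γ ^ 2 / 2) * ‖w i - wbar‖ ^ 2
      + (β * γ ^ 2 / 2) * ‖u i‖ ^ 2 - (β * γ ^ 2 / 2) * ‖w i‖ ^ 2 := by
    intro i
    have h1 := hlower (x - γ • wbar) (x - γ • w i)
    have h2 := hupper (x - γ • ubar) (x - γ • u i)
    have h3 := hscore i
    rw [key, key2, real_inner_smul_right] at h1 h2
    rw [hρ] at h3
    have h4 : 0 ≤ (β + μ) * (γ ^ 2 * ‖w i - wbar‖ ^ 2) :=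
      mul_nonneg (by linarith) (by positivity)
    linarith
  have S := Finset.sum_le_sum (fun i (_ : i ∈ Finset.univ) => main i)
  simp only [Finset.sum_add_distrib, Finset.sum_sub_distrib, ← Finset.mul_sum,
    zeno_lin w wbar _ hw, zeno_lin u ubar _ hu, Finset.sum_const, Finset.card_univ,
    Fintype.card_fin, nsmul_eq_mul] at S
  have V1 := mul_le_mul_of_nonneg_left (zeno_var w wbar hw)
    (by positivity : 0 ≤ β * γ ^ 2 / 2)
  have V2 := mul_le_mul_of_nonneg_left (zeno_var u ubar hu)
    (by positivity : 0 ≤ L * γ ^ 2 / 2)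
  have e : (k : ℝ) * ((L + β) * γ ^ 2 / (2 * k) * ∑ i, ‖u i‖ ^ 2)
      = L * γ ^ 2 / 2 * ∑ i, ‖u i‖ ^ 2 + β * γ ^ 2 / 2 * ∑ i, ‖u i‖ ^ 2 := by
    field_simp
  refine le_of_mul_le_mul_left ?_ hk0
  rw [mul_add, e]
  linarith
end

section
/- Fix x ∈ ℝ^d, integers 0 ≤ q ≤ b < m, γ > 0, ρ = βγ²/2 with β ≥ 0, β ≥ −μ. Let h : ℝ^d → ℝ be differentiable, L-smooth and μ-weakly convex (μ ≤ L, L > 0) with γ ≤ 1/L. Let ṽ_1, …, ṽ_m ∈ ℝ^d contain m−q designated correct vectors, let ṽ_(1), …, ṽ_(m) be all candidates sorted in non-increasing order of the score u ↦ h(x) − h(x − γu) − ρ‖u‖², let v_(1), …, v_(m−q) be the correct vectors so sorted, and set v̄̃ = (1/(m−b)) Σ_{i=1}^{m−b} ṽ_(i) and v̄ = (1/(m−b)) Σ_{i=1}^{m−b} v_(i). Then h(x − γ v̄̃) − h(x) ≤ −(γ/2)‖∇h(x)‖² + (γ/2)‖∇h(x) − v̄‖² + ((L + β) γ² / (2(m−b)))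 Σ_{i=1}^{m−b} ‖v_(i)‖². -/
open scoped RealInnerProductSpace

lemma zeno_rank {m n k : ℕ} (f : Fin n → Fin m) (hf : Function.Injective f)
    (i : Fin n) (hk : k = i.val) : ∃ j : Fin n, j ≤ i ∧ k ≤ (f j).val := by
  by_contra! hc
  have h1 : (Finset.Iic i).card ≤ (Finset.range k).card := by
    apply Finset.card_le_card_of_injOn (fun j => (f j).val)
    · intro j hj
      simpa using hc j (by simpa using hj)
    · intro a _ c _ hac
      exact hf (Fin.ext hac)
  simp at h1
  omega

/-- Pathwise one-step descent inequality of Zeno (conditional on the evaluation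
function `h = f_r`).  Among `m` candidates `vtil` (of which the `m - q` vectors
`vtil (ι i)` are correct), sort all candidates by the score
`u ↦ h x - h (x - γ u) - ρ ‖u‖²` via `σ` and the correct ones via `τ`; let `vtbar` be the
average of the `m - b` highest-scoring candidates (the Zeno output) and `vbar` the average
of the `m - b` highest-scoring correct vectors.  Then
`h (x - γ vtbar) - h x ≤ -(γ/2)‖∇h x‖² + (γ/2)‖∇h x - vbar‖²
  + ((L+β)γ²/(2(m-b))) Σ_{i<m-b} ‖v_(i)‖²`. -/
theorem zeno_pathwise_descent {d m q b : ℕ} (hqb : q ≤ b) (hbm : b < m)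
    (L μ γ β ρ : ℝ) (hL : 0 < L) (hμL : μ ≤ L)
    (hγ0 : 0 < γ) (hγL : γ ≤ 1 / L)
    (hβ0 : 0 ≤ β) (hβμ : -μ ≤ β) (hρ : ρ = β * γ ^ 2 / 2)
    (h : EuclideanSpace ℝ (Fin d) → ℝ)
    (hdiff : Differentiable ℝ h)
    (hlower : ∀ x y : EuclideanSpace ℝ (Fin d),
      ⟪gradient h x, y - x⟫ + μ / 2 * ‖y - x‖ ^ 2 ≤ h y - h x)
    (hupper : ∀ x y : EuclideanSpace ℝ (Fin d),
      h y - h x ≤ ⟪gradient h x, y - x⟫ + L / 2 * ‖y - x‖ ^ 2)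
    (x : EuclideanSpace ℝ (Fin d))
    (vtil : Fin m → EuclideanSpace ℝ (Fin d))
    (ι : Fin (m - q) ↪ Fin m)
    (σ : Equiv.Perm (Fin m))
    (hσ : ∀ i j : Fin m, i ≤ j →
      h x - h (x - γ • vtil (σ j)) - ρ * ‖vtil (σ j)‖ ^ 2 ≤
        h x - h (x - γ • vtil (σ i)) - ρ * ‖vtil (σ i)‖ ^ 2)
    (τ : Equiv.Perm (Fin (m - q)))
    (hτ : ∀ i j : Fin (m - q), i ≤ j →
      h x - h (x - γ • vtil (ι (τ j))) - ρ * ‖vtil (ι (τ j))‖ ^ 2 ≤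
        h x - h (x - γ • vtil (ι (τ i))) - ρ * ‖vtil (ι (τ i))‖ ^ 2)
    (vtbar vbar : EuclideanSpace ℝ (Fin d))
    (hvtbar : vtbar = ((m : ℝ) - b)⁻¹ •
      ∑ i : Fin (m - b), vtil (σ (Fin.castLE (Nat.sub_le m b) i)))
    (hvbar : vbar = ((m : ℝ) - b)⁻¹ •
      ∑ i : Fin (m - b), vtil (ι (τ (Fin.castLE (Nat.sub_le_sub_left hqb m) i)))) :
    h (x - γ • vtbar) - h x ≤
      -(γ / 2) * ‖gradient h x‖ ^ 2 + γ / 2 * ‖gradient h x - vbar‖ ^ 2 +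
        (L + β) * γ ^ 2 / (2 * ((m : ℝ) - b)) *
          ∑ i : Fin (m - b), ‖vtil (ι (τ (Fin.castLE (Nat.sub_le_sub_left hqb m) i)))‖ ^ 2 := by
  have hkm : ((m - b : ℕ) : ℝ) = (m : ℝ) - b := by
    rw [Nat.cast_sub hbm.le]
  have hkpos : (0 : ℝ) < (m : ℝ) - b := by
    have : (b : ℝ) < m := by exact_mod_cast hbm
    linarith
  have hρ0 : 0 ≤ ρ := by rw [hρ]; positivity
  set k : ℝ := (m : ℝ) - b with hk
  set w : Fin (m - b) → EuclideanSpace ℝ (Fin d) :=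
    fun i => vtil (σ (Fin.castLE (Nat.sub_le m b) i)) with hw
  set v : Fin (m - b) → EuclideanSpace ℝ (Fin d) :=
    fun i => vtil (ι (τ (Fin.castLE (Nat.sub_le_sub_left hqb m) i))) with hv
  change vtbar = k⁻¹ • ∑ i, w i at hvtbar
  change vbar = k⁻¹ • ∑ i, v i at hvbar
  change _ ≤ _ + (L + β) * γ ^ 2 / (2 * k) * ∑ i, ‖v i‖ ^ 2
  have hws : ∑ i, w i = k • vtbar := by
    rw [hvtbar, smul_smul, mul_inv_cancel₀ hkpos.ne', one_smul]
  have hvs : ∑ i, v i = k • vbar := by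
    rw [hvbar, smul_smul, mul_inv_cancel₀ hkpos.ne', one_smul]
  -- score comparison
  have hscore : ∀ i, h (x - γ • w i) + ρ * ‖w i‖ ^ 2 ≤ h (x - γ • v i) + ρ * ‖v i‖ ^ 2 := by
    intro i
    obtain ⟨j, hj, hij⟩ := zeno_rank (k := i.val) (fun j => σ.symm (ι (τ j)))
      (fun a c hac => τ.injective (ι.injective (σ.symm.injective hac)))
      (Fin.castLE (Nat.sub_le_sub_left hqb m) i) rfl
    have h1 := hτ j _ hj
    have h2 := hσ (Fin.castLE (Nat.sub_le m b) i) (σ.symm (ι (τ j))) hij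
    rw [Equiv.apply_symm_apply] at h2
    simp only [hw, hv]
    linarith
  -- weak convexity
  have hconv : ∀ i, h (x - γ • vtbar) ≤ h (x - γ • w i) + ρ * ‖w i‖ ^ 2 +
      ⟪γ • gradient h (x - γ • vtbar) - (2 * ρ) • vtbar, w i - vtbar⟫ := by
    intro i
    have h1 := hlower (x - γ • vtbar) (x - γ • w i)
    have e : x - γ • w i - (x - γ • vtbar) = (-γ) • (w i - vtbar) := by module
    rw [e, norm_smul, inner_smul_right, mul_pow] at h1
    rw [inner_sub_left, inner_smul_left, inner_smul_left]
    have e2 : ‖w i‖ ^ 2 = ‖w i - vtbar‖ ^ 2 + 2 * ⟪vtbar, w i - vtbar⟫ + ‖vtbar‖ ^ 2 := by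
      have := norm_add_sq_real (w i - vtbar) vtbar
      rw [sub_add_cancel, real_inner_comm] at this
      exact this
    rw [e2]
    simp only [Real.norm_eq_abs, abs_neg, sq_abs, conj_trivial] at h1 ⊢
    have h3 : -(μ / 2 * (γ ^ 2 * ‖w i - vtbar‖ ^ 2)) ≤ ρ * ‖w i - vtbar‖ ^ 2 := by
      rw [hρ]
      have : 0 ≤ (β + μ) * (γ ^ 2 * ‖w i - vtbar‖ ^ 2) :=
        mul_nonneg (by linarith) (by positivity)
      linarith
    have h4 : 0 ≤ ρ * ‖vtbar‖ ^ 2 := by positivity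
    linarith
  have hup : ∀ i, h (x - γ • v i) + ρ * ‖v i‖ ^ 2 ≤
      h x - γ * ⟪gradient h x, v i⟫ + (L + β) * γ ^ 2 / 2 * ‖v i‖ ^ 2 := by
    intro i
    have h1 := hupper x (x - γ • v i)
    have e : x - γ • v i - x = (-γ) • v i := by module
    rw [e, norm_smul, inner_smul_right, mul_pow] at h1
    simp only [Real.norm_eq_abs, abs_neg, sq_abs] at h1
    rw [hρ]
    linarith
  have hall : ∑ _i : Fin (m - b), h (x - γ • vtbar) ≤ ∑ i : Fin (m - b),
      (h x - γ * ⟪gradient h x, v i⟫ + (L + β) * γ ^ 2 / 2 * ‖v i‖ ^ 2 +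
      ⟪γ • gradient h (x - γ • vtbar) - (2 * ρ) • vtbar, w i - vtbar⟫) := by
    apply Finset.sum_le_sum
    intro i _
    linarith [hscore i, hconv i, hup i]
  have hz : ∑ i, (w i - vtbar) = 0 := by
    rw [Finset.sum_sub_distrib, hws, Finset.sum_const, Finset.card_univ, Fintype.card_fin,
      ← Nat.cast_smul_eq_nsmul ℝ, hkm, sub_self]
  rw [Finset.sum_add_distrib, ← inner_sum, hz, inner_zero_right, Finset.sum_add_distrib,
    Finset.sum_sub_distrib, ← Finset.mul_sum, ← Finset.mul_sum, ← inner_sum, hvs,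
    inner_smul_right, Finset.sum_const, Finset.sum_const, Finset.card_univ, Fintype.card_fin,
    nsmul_eq_mul, nsmul_eq_mul, hkm] at hall
  rw [norm_sub_sq_real]
  have h5 : 0 ≤ γ / 2 * ‖vbar‖ ^ 2 := by positivity
  have h6 : h (x - γ • vtbar) - h x ≤ -γ * ⟪gradient h x, vbar⟫ +
      (L + β) * γ ^ 2 / (2 * k) * ∑ i, ‖v i‖ ^ 2 := by
    rw [← mul_le_mul_iff_right₀ hkpos]
    have : k * (-γ * ⟪gradient h x, vbar⟫ + (L + β) * γ ^ 2 / (2 * k) * ∑ i, ‖v i‖ ^ 2) =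
        -γ * (k * ⟪gradient h x, vbar⟫) + (L + β) * γ ^ 2 / 2 * ∑ i, ‖v i‖ ^ 2 := by
      field_simp
    rw [this]
    linarith
  linarith
end
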